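/- arXiv:2510.25104 — 4 statements merged into one kernel-verified Lean document; each statement's English description precedes it below -/
import Mathlib

section
/- For every nonnegative integer n, F(n) = p̄(n); that is, the number of two-color (blue/green) partitions of n in which even parts may occur only in the blue color equals the number of overpartitions of n. -/
noncomputable section

/-- Overpartitions of `n`: the first component is the set of overlined parts
(at most one overlined part of each size), the second is the multiset of
non-overlined parts; all parts are positive and the total sum is `n`. -/
def overpartitions (n : ℕ) : Set (Finset ℕ × Multiset ℕ) :=
  {p | (∀ x ∈ p.1, 0 < x) ∧ (∀ x ∈ p.2, 0 < x) ∧ p.1.sum id + p.2.sum = n}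

/-- `p̄(n)`, the number of overpartitions of `n`. -/
def pbar (n : ℕ) : ℕ := (overpartitions n).ncard

/-- Overpartitions of `n` into odd parts. -/
def overpartitionsOdd (n : ℕ) : Set (Finset ℕ × Multiset ℕ) :=
  {p | p ∈ overpartitions n ∧ (∀ x ∈ p.1, Odd x) ∧ ∀ x ∈ p.2, Odd x}

/-- `p̄_o(n)`, the number of overpartitions of `n` into odd parts. -/
def pbarOdd (n : ℕ) : ℕ := (overpartitionsOdd n).ncard

/-- Two-color partitions of `n` (first component: blue parts, second: green
parts) in which even parts may occur only in the blue color, i.e. all green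
parts are odd. -/
def FSet (n : ℕ) : Set (Multiset ℕ × Multiset ℕ) :=
  {p | (∀ x ∈ p.1, 0 < x) ∧ (∀ x ∈ p.2, 0 < x) ∧ p.1.sum + p.2.sum = n ∧
    ∀ x ∈ p.2, Odd x}

/-- `F(n)`. -/
def Fcount (n : ℕ) : ℕ := (FSet n).ncard

/-- The number of even parts of a multiset of naturals. -/
def evenParts (m : Multiset ℕ) : ℕ := Multiset.card (m.filter (fun x => Even x))

/-- `F₀(n)`: partitions counted by `F(n)` with an even number of even parts. -/
def F0 (n : ℕ) : ℕ := {p ∈ FSet n | Even (evenParts (p.1 + p.2))}.ncard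

/-- `F₁(n)`: partitions counted by `F(n)` with an odd number of even parts. -/
def F1 (n : ℕ) : ℕ := {p ∈ FSet n | Odd (evenParts (p.1 + p.2))}.ncard

/-- `F₂(n)`: partitions counted by `F(n)` with an even number of parts. -/
def F2 (n : ℕ) : ℕ := {p ∈ FSet n | Even (Multiset.card (p.1 + p.2))}.ncard

/-- `F₃(n)`: partitions counted by `F(n)` with an odd number of parts. -/
def F3 (n : ℕ) : ℕ := {p ∈ FSet n | Odd (Multiset.card (p.1 + p.2))}.ncard

/-- Partitions counted by `F(n)` whose blue parts are distinct odd numbers. -/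
def QSet (n : ℕ) : Set (Multiset ℕ × Multiset ℕ) :=
  {p | p ∈ FSet n ∧ (∀ x ∈ p.1, Odd x) ∧ p.1.Nodup}

/-- `Q(n)`. -/
def Qcount (n : ℕ) : ℕ := (QSet n).ncard

/-- Two-color partitions of `n` (first component: blue parts, second: green
parts) in which odd parts may occur only in the blue color, i.e. all green
parts are even. -/
def GSet (n : ℕ) : Set (Multiset ℕ × Multiset ℕ) :=
  {p | (∀ x ∈ p.1, 0 < x) ∧ (∀ x ∈ p.2, 0 < x) ∧ p.1.sum + p.2.sum = n ∧
    ∀ x ∈ p.2, Even x}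

/-- `G(n)`. -/
def Gcount (n : ℕ) : ℕ := (GSet n).ncard

/-- `G₀(n)`: partitions counted by `G(n)` with an even number of blue even parts. -/
def G0 (n : ℕ) : ℕ := {p ∈ GSet n | Even (evenParts p.1)}.ncard

/-- `G₁(n)`: partitions counted by `G(n)` with an odd number of blue even parts. -/
def G1 (n : ℕ) : ℕ := {p ∈ GSet n | Odd (evenParts p.1)}.ncard

/-- `G₂(n)`: partitions counted by `G(n)` with an even number of blue parts. -/
def G2 (n : ℕ) : ℕ := {p ∈ GSet n | Even (Multiset.card p.1)}.ncard

/-- `G₃(n)`: partitions counted by `G(n)` with an odd number of blue parts. -/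
def G3 (n : ℕ) : ℕ := {p ∈ GSet n | Odd (Multiset.card p.1)}.ncard

/-- `G₄(n)`: partitions counted by `G(n)` with an even total number of parts. -/
def G4 (n : ℕ) : ℕ := {p ∈ GSet n | Even (Multiset.card (p.1 + p.2))}.ncard

/-- `G₅(n)`: partitions counted by `G(n)` with an odd total number of parts. -/
def G5 (n : ℕ) : ℕ := {p ∈ GSet n | Odd (Multiset.card (p.1 + p.2))}.ncard

/-- Partitions of `n` in which the odd parts are distinct. -/
def HSet (n : ℕ) : Set (Multiset ℕ) :=
  {m | (∀ x ∈ m, 0 < x) ∧ m.sum = n ∧ (m.filter (fun x => Odd x)).Nodup}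

/-- `H(n)`. -/
def Hcount (n : ℕ) : ℕ := (HSet n).ncard

/-- Partitions of `n` into distinct parts whose even parts are all
congruent to `2` modulo `4`. -/
def KSet (n : ℕ) : Set (Finset ℕ) :=
  {s | (∀ x ∈ s, 0 < x) ∧ s.sum id = n ∧ ∀ x ∈ s, Even x → x % 4 = 2}

/-- `K(n)`: the signed count of partitions in `KSet n`, each weighted by
`(-1)^j` where `j` is the number of even parts. -/
def Kcount (n : ℕ) : ℤ :=
  ({s ∈ KSet n | Even (s.filter (fun x => Even x)).card}.ncard : ℤ) -
  ({s ∈ KSet n | Odd (s.filter (fun x => Even x)).card}.ncard : ℤ)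

/-- Partitions counted by `G(n)` whose blue parts are distinct odd numbers. -/
def RSet (n : ℕ) : Set (Multiset ℕ × Multiset ℕ) :=
  {p | p ∈ GSet n ∧ (∀ x ∈ p.1, Odd x) ∧ p.1.Nodup}

/-- `R(n)`. -/
def Rcount (n : ℕ) : ℕ := (RSet n).ncard

/-- Two-color partitions of `n` in which all parts of the same color are
distinct and odd parts may occur only in the blue color: the first component
is the (finite) set of blue parts (distinct positive integers), the second the
set of green parts (distinct positive even integers). -/
def LSet (n : ℕ) : Set (Finset ℕ × Finset ℕ) :=
  {p | (∀ x ∈ p.1, 0 < x) ∧ (∀ x ∈ p.2, 0 < x ∧ Even x) ∧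
    p.1.sum id + p.2.sum id = n}

/-- `L₀(n)`: partitions counted by `L(n)` with an even number of blue even parts. -/
def L0 (n : ℕ) : ℕ := {p ∈ LSet n | Even (p.1.filter (fun x => Even x)).card}.ncard

/-- `L₁(n)`: partitions counted by `L(n)` with an odd number of blue even parts. -/
def L1 (n : ℕ) : ℕ := {p ∈ LSet n | Odd (p.1.filter (fun x => Even x)).card}.ncard

/-- `L₂(n)`: partitions counted by `L(n)` with an even number of blue parts. -/
def L2 (n : ℕ) : ℕ := {p ∈ LSet n | Even p.1.card}.ncard

/-- `L₃(n)`: partitions counted by `L(n)` with an odd number of blue parts. -/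
def L3 (n : ℕ) : ℕ := {p ∈ LSet n | Odd p.1.card}.ncard

theorem euler_aux (k : ℕ) : ∃ f : Multiset ℕ → Finset ℕ,
    Set.BijOn f {m | (∀ x ∈ m, 0 < x) ∧ (∀ x ∈ m, Odd x) ∧ m.sum = k}
      {s | (∀ x ∈ s, 0 < x) ∧ s.sum id = k} := by
  have h1 : {m : Multiset ℕ | (∀ x ∈ m, 0 < x) ∧ (∀ x ∈ m, Odd x) ∧ m.sum = k} =
      (fun p : k.Partition => p.parts) '' (Nat.Partition.odds k : Set k.Partition) := by
    ext m
    simp only [Set.mem_ofPred_eq, Set.mem_image, Finset.mem_coe, Nat.Partition.odds,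
      Nat.Partition.restricted, Finset.mem_filter, Finset.mem_univ, true_and, Nat.not_even_iff_odd]
    constructor
    · rintro ⟨a, b, c⟩
      exact ⟨⟨m, fun {i} hi => a i hi, c⟩, b, rfl⟩
    · rintro ⟨p, hp, rfl⟩
      exact ⟨fun x hx => p.parts_pos hx, hp, p.parts_sum⟩
  have h2 : {s : Finset ℕ | (∀ x ∈ s, 0 < x) ∧ s.sum id = k} =
      (fun p : k.Partition => p.parts.toFinset) ''
        (Nat.Partition.distincts k : Set k.Partition) := by
    ext s
    simp only [Set.mem_ofPred_eq, Set.mem_image, Finset.mem_coe, Nat.Partition.distincts,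
      Finset.mem_filter, Finset.mem_univ, true_and]
    constructor
    · rintro ⟨a, c⟩
      refine ⟨⟨s.val, fun {i} hi => a i hi, ?_⟩, s.nodup, ?_⟩
      · rw [← c]; simp only [Finset.sum, Multiset.map_id]
      · simp
    · rintro ⟨p, hp, rfl⟩
      refine ⟨fun x hx => p.parts_pos (Multiset.mem_toFinset.1 hx), ?_⟩
      have := p.parts_sum
      simp only [Finset.sum, Multiset.toFinset_val, Multiset.dedup_eq_self.2 hp, Multiset.map_id]
      exact this
  rw [h1, h2]
  have i2 : Set.InjOn (fun p : k.Partition => p.parts.toFinset)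
      (Nat.Partition.distincts k : Set k.Partition) := by
    intro p hp q hq h
    simp only [Finset.mem_coe, Nat.Partition.distincts,
      Finset.mem_filter, Finset.mem_univ, true_and] at hp hq
    apply Nat.Partition.ext
    have := congrArg Finset.val h
    simpa [Multiset.dedup_eq_self.2 hp, Multiset.dedup_eq_self.2 hq] using this
  have i1 : Function.Injective (fun p : k.Partition => p.parts) :=
    fun p q h => Nat.Partition.ext h
  apply Set.Finite.exists_bijOn_of_encard_eq
  · exact (Finset.finite_toSet _).image _
  · rw [i1.injOn.encard_image, i2.encard_image, Set.encard_coe_eq_coe_finsetCard,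
      Set.encard_coe_eq_coe_finsetCard, Nat.Partition.card_odds_eq_card_distincts]

/-- For every nonnegative integer `n`, `F(n) = p̄(n)`. -/
theorem F_eq_pbar (n : ℕ) : Fcount n = pbar n := by
  choose f hf using euler_aux
  unfold Fcount pbar
  refine Set.ncard_congr (fun p _ => (f p.2.sum p.2, p.1)) ?_ ?_ ?_
  · rintro ⟨a, b⟩ ⟨h1, h2, h3, h4⟩
    obtain ⟨h5, h6⟩ := (hf b.sum).mapsTo ⟨h2, h4, rfl⟩
    refine ⟨h5, h1, ?_⟩
    simp only at h3 h6 ⊢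
    omega
  · rintro ⟨a, b⟩ ⟨c, d⟩ ⟨h1, h2, h3, h4⟩ ⟨g1, g2, g3, g4⟩ h
    simp only [Prod.mk.injEq] at h h3 g3 ⊢
    obtain ⟨h, rfl⟩ := h
    have e : b.sum = d.sum := by omega
    rw [← e] at h
    exact ⟨rfl, (hf b.sum).injOn ⟨h2, h4, rfl⟩ ⟨g2, g4, e.symm⟩ h⟩
  · rintro ⟨s, m⟩ ⟨h1, h2, h3⟩
    obtain ⟨b, ⟨b1, b2, b3⟩, hb⟩ := (hf (s.sum id)).surjOn ⟨h1, rfl⟩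
    refine ⟨(m, b), ⟨h2, b1, ?_, b2⟩, ?_⟩
    · simp only at h3 ⊢
      omega
    · simp only [b3, hb]
end
end

section
/- For every nonnegative integer n, F_0(n) = (p̄(n) + p̄_o(n))/2, where F_0(n) counts the partitions counted by F(n) having an even number of even parts. -/
noncomputable section

section helpers
open PowerSeries PowerSeries.WithPiTopology Finset

def gf (u : Multiset ℕ → ℤ) : PowerSeries ℤ :=
  PowerSeries.mk fun n => ∑ p : n.Partition, u p.parts

def wt (g : ℕ → ℤ) (s : Multiset ℕ) : ℤ := (s.map g).prod

def dw (Q : ℕ → Prop) [DecidablePred Q] (s : Multiset ℕ) : ℤ :=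
  if s.Nodup ∧ ∀ x ∈ s, Q x then 1 else 0

def facA (g : ℕ → ℤ) (i : ℕ) : PowerSeries ℤ :=
  1 + ∑' j : ℕ, C (g (i+1) ^ (j + 1)) * (X : PowerSeries ℤ) ^ ((i + 1) * (j + 1))

def facB (Q : ℕ → Prop) [DecidablePred Q] (i : ℕ) : PowerSeries ℤ :=
  if Q (i+1) then 1 + X ^ (i+1) else 1

lemma hasProd_A (g : ℕ → ℤ) : HasProd (facA g) (gf (wt g)) := by
  convert! Nat.Partition.hasProd_genFun (R := ℤ) (fun i c => g i ^ c) using 1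
  · ext1 i
    simp only [facA, PowerSeries.smul_eq_C_mul]
  unfold gf Nat.Partition.genFun wt
  congr 1
  ext n
  refine Finset.sum_congr rfl fun p _ => ?_
  rw [Finset.prod_multiset_map_count]
  simp [Finsupp.prod]

lemma hasProd_B (Q : ℕ → Prop) [DecidablePred Q] : HasProd (facB Q) (gf (dw Q)) := by
  convert! Nat.Partition.hasProd_genFun (R := ℤ) (fun i c => if c ≤ 1 ∧ Q i then 1 else 0) using 1
  · ext1 i
    simp only [PowerSeries.smul_eq_C_mul]
    rw [tsum_eq_single 0]
    · unfold facB
      by_cases h : Q (i+1) <;> simp [h]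
    · intro j hj
      have : ¬ (j + 1 ≤ 1) := by omega
      simp [this]
  · unfold gf Nat.Partition.genFun dw
    congr 1
    ext n
    refine Finset.sum_congr rfl fun p _ => ?_
    simp only [Finsupp.prod, Finset.prod_boole]
    simp only [Multiset.toFinsupp_support, Multiset.mem_toFinset, Multiset.toFinsupp_apply]
    congr 1
    rw [Multiset.nodup_iff_count_le_one]
    apply propext
    constructor
    · rintro ⟨h1, h2⟩ i hi
      exact ⟨h1 i, h2 i hi⟩
    · intro h
      refine ⟨fun a => ?_, fun x hx => (h x hx).2⟩
      by_cases ha : a ∈ p.parts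
      · exact (h a ha).1
      · simp [Multiset.count_eq_zero_of_notMem ha]

lemma facA_mul (g : ℕ → ℤ) (i : ℕ) : facA g i * (1 - C (g (i+1)) * X ^ (i+1)) = 1 := by
  have h0 : constantCoeff (C (g (i+1)) * (X : PowerSeries ℤ) ^ (i+1)) = 0 := by simp
  have := tsum_pow_mul_one_sub_of_constantCoeff_eq_zero h0
  refine Eq.trans ?_ this
  congr 1
  rw [(summable_pow_of_constantCoeff_eq_zero h0).tsum_eq_zero_add, facA]
  simp only [pow_zero]
  congr 1
  refine tsum_congr fun j => ?_
  rw [mul_pow, ← pow_mul, map_pow]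

def sg (i : ℕ) : ℤ := if Even i then -1 else 1
def og (i : ℕ) : ℤ := if Even i then 0 else 1

lemma G_mul_DE : gf (wt sg) * gf (dw (fun i => Even i)) = gf (wt og) := by
  refine ((hasProd_A sg).mul (hasProd_B _)).unique ?_
  convert! hasProd_A og using 1
  ext1 i
  by_cases h : Even (i+1)
  · have h1 := facA_mul sg i
    have h2 := facA_mul og i
    simp only [sg, og, h, if_true, map_zero, map_neg, map_one, zero_mul, sub_zero, mul_one, neg_mul, one_mul,
      sub_neg_eq_add] at h1 h2
    simp only [facB, h, if_true]
    rw [h1, h2]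
  · simp [facA, facB, h, sg, og]

lemma DO_mul_DE : gf (dw (fun i => Odd i)) * gf (dw (fun i => Even i)) = gf (dw (fun _ => True)) := by
  refine ((hasProd_B _).mul (hasProd_B _)).unique ?_
  convert! hasProd_B (fun _ => True) using 1
  ext1 i
  rcases Nat.even_or_odd (i+1) with h | h
  · simp [facB, h, Nat.not_odd_iff_even.mpr h]
  · simp [facB, h, Nat.not_even_iff_odd.mpr h]

lemma wt_og (s : Multiset ℕ) : wt og s = if ∀ x ∈ s, Odd x then 1 else 0 := by
  induction s using Multiset.induction with
  | empty => simp [wt]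
  | cons a s ih =>
    have : wt og (a ::ₘ s) = og a * wt og s := by simp [wt]
    rw [this, ih]
    rcases Nat.even_or_odd a with h | h
    · simp [og, h, Nat.not_odd_iff_even.mpr h]
    · simp [og, h, Nat.not_even_iff_odd.mpr h]

lemma wt_sg (s : Multiset ℕ) : wt sg s = (-1) ^ evenParts s := by
  induction s using Multiset.induction with
  | empty => simp [wt, evenParts]
  | cons a s ih =>
    have : wt sg (a ::ₘ s) = sg a * wt sg s := by simp [wt]
    rw [this, ih]
    by_cases h : Even a
    · simp [sg, h, evenParts, pow_succ]
    · simp [sg, h, evenParts]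

lemma euler : gf (wt og) = gf (dw (fun _ => True)) := by
  ext n
  have := Nat.Partition.card_odds_eq_card_distincts n
  simp only [gf, coeff_mk]
  rw [Nat.Partition.odds, Nat.Partition.restricted, Nat.Partition.distincts, card_filter,
    card_filter] at this
  zify at this
  simpa [wt_og, dw] using this

lemma G_eq : gf (wt sg) = gf (dw (fun i => Odd i)) := by
  have hne : gf (dw (fun i => Even i)) ≠ 0 := by
    intro h
    have := congrArg (coeff 0) h
    simp [gf, dw] at this
  apply mul_right_cancel₀ hne
  rw [G_mul_DE, DO_mul_DE, euler]

def PM (n : ℕ) : Finset (Multiset ℕ) := (univ : Finset n.Partition).image (fun p => p.parts)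

lemma mem_PM (n : ℕ) (s : Multiset ℕ) : s ∈ PM n ↔ (∀ x ∈ s, 0 < x) ∧ s.sum = n := by
  simp only [PM, mem_image, mem_univ, true_and]
  constructor
  · rintro ⟨p, rfl⟩
    exact ⟨fun x hx => p.parts_pos hx, p.parts_sum⟩
  · rintro ⟨h1, h2⟩
    exact ⟨⟨s, fun {i} hi => h1 i hi, h2⟩, rfl⟩

def TT (n : ℕ) : Finset (Multiset ℕ × Multiset ℕ) :=
  (antidiagonal n).biUnion fun ab => PM ab.1 ×ˢ PM ab.2

lemma mem_TT (n : ℕ) (p : Multiset ℕ × Multiset ℕ) : p ∈ TT n ↔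
    (∀ x ∈ p.1, 0 < x) ∧ (∀ x ∈ p.2, 0 < x) ∧ p.1.sum + p.2.sum = n := by
  simp only [TT, mem_biUnion, mem_product, mem_PM, HasAntidiagonal.mem_antidiagonal]
  constructor
  · rintro ⟨ab, h, h1, h2⟩
    exact ⟨h1.1, h2.1, by rw [h1.2, h2.2, h]⟩
  · rintro ⟨h1, h2, h3⟩
    exact ⟨(p.1.sum, p.2.sum), h3, ⟨h1, rfl⟩, ⟨h2, rfl⟩⟩

lemma sum_TT (n : ℕ) (u v : Multiset ℕ → ℤ) :
    ∑ p ∈ TT n, u p.1 * v p.2 = coeff n (gf u * gf v) := by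
  rw [TT, sum_biUnion, coeff_mul]
  · refine sum_congr rfl fun ab _ => ?_
    rw [sum_product, ← sum_mul_sum]
    simp only [gf, coeff_mk, PM]
    rw [sum_image, sum_image]
    · intro p _ q _ h
      exact Nat.Partition.ext h
    · intro p _ q _ h
      exact Nat.Partition.ext h
  · intro a _ b _ hab
    rw [Function.onFun, Finset.disjoint_left]
    intro p hp hq
    simp only [mem_product, mem_PM] at hp hq
    exact hab (Prod.ext (hp.1.2.symm.trans hq.1.2) (hp.2.2.symm.trans hq.2.2))

lemma over_eq (S : Set (Finset ℕ × Multiset ℕ)) (n : ℕ) (P : Multiset ℕ × Multiset ℕ → Prop)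
    [DecidablePred P] (h : ∀ p, p ∈ S ↔ p ∈ overpartitions n ∧ P (p.1.val, p.2)) :
    (S.ncard : ℤ) = ∑ p ∈ TT n, if p.1.Nodup ∧ P p then 1 else 0 := by
  have hinj : Function.Injective (fun p : Finset ℕ × Multiset ℕ => (p.1.val, p.2)) := by
    intro p q hpq
    simp only [Prod.mk.injEq, Finset.val_inj] at hpq
    exact Prod.ext hpq.1 hpq.2
  rw [← Set.ncard_image_of_injective S hinj]
  have : (fun p : Finset ℕ × Multiset ℕ => (p.1.val, p.2)) '' S =
      ↑((TT n).filter (fun p => p.1.Nodup ∧ P p)) := by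
    ext ⟨s, t⟩
    simp only [Set.mem_image, h, overpartitions, Set.mem_ofPred_eq, coe_filter, mem_TT]
    constructor
    · rintro ⟨⟨s', t'⟩, ⟨⟨h1, h2, h3⟩, h4⟩, h5⟩
      simp only [Prod.mk.injEq] at h5
      obtain ⟨rfl, rfl⟩ := h5
      refine ⟨⟨h1, h2, ?_⟩, s'.nodup, h4⟩
      rwa [Finset.sum, Multiset.map_id] at h3
    · rintro ⟨⟨h1, h2, h3⟩, h4, h5⟩
      refine ⟨(⟨s, h4⟩, t), ⟨⟨h1, h2, ?_⟩, h5⟩, rfl⟩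
      rwa [Finset.sum, Multiset.map_id]
  rw [this, Set.ncard_coe_finset, card_filter]
  push_cast
  rfl

lemma pbar_coeff (n : ℕ) : (pbar n : ℤ) = coeff n (gf (dw (fun _ => True)) * gf (wt (fun _ => 1))) := by
  rw [← sum_TT, pbar, over_eq _ n (fun _ => True) (by simp)]
  refine sum_congr rfl fun p _ => ?_
  simp [dw, wt]

lemma pbarOdd_coeff (n : ℕ) :
    (pbarOdd n : ℤ) = coeff n (gf (dw (fun i => Odd i)) * gf (wt og)) := by
  classical
  rw [← sum_TT, pbarOdd, over_eq _ n (fun p => (∀ x ∈ p.1, Odd x) ∧ ∀ x ∈ p.2, Odd x)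
    (by intro p; rfl)]
  refine sum_congr rfl fun p _ => ?_
  rw [wt_og, dw, ite_zero_mul_ite_zero]
  simp [and_assoc]

lemma F0_coeff (n : ℕ) :
    2 * (F0 n : ℤ) = coeff n (gf (wt (fun _ => 1)) * gf (wt og)) + coeff n (gf (wt sg) * gf (wt og)) := by
  classical
  rw [← sum_TT, ← sum_TT, ← sum_add_distrib, F0]
  have : {p ∈ FSet n | Even (evenParts (p.1 + p.2))} =
      ↑((TT n).filter (fun p => (∀ x ∈ p.2, Odd x) ∧ Even (evenParts p.1))) := by
    ext ⟨s, t⟩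
    simp only [FSet, Set.mem_ofPred_eq, coe_filter, mem_TT]
    have key : (∀ x ∈ t, Odd x) → evenParts (s + t) = evenParts s := by
      intro h
      have : t.filter (fun x => Even x) = 0 := by
        rw [Multiset.filter_eq_nil]
        intro a ha
        exact Nat.not_even_iff_odd.mpr (h a ha)
      simp [evenParts, Multiset.filter_add, this]
    constructor
    · rintro ⟨⟨h1, h2, h3, h4⟩, h5⟩
      exact ⟨⟨h1, h2, h3⟩, h4, key h4 ▸ h5⟩
    · rintro ⟨⟨h1, h2, h3⟩, h4, h5⟩
      exact ⟨⟨h1, h2, h3, h4⟩, (key h4).symm ▸ h5⟩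
  rw [this, Set.ncard_coe_finset, card_filter]
  push_cast
  rw [mul_sum]
  refine sum_congr rfl fun p _ => ?_
  rw [wt_og, wt_sg]
  by_cases h : ∀ x ∈ p.2, Odd x
  · rw [if_pos h]
    rcases Nat.even_or_odd (evenParts p.1) with h' | h'
    · rw [if_pos ⟨h, h'⟩, h'.neg_one_pow]
      simp [wt]
    · rw [if_neg (fun hh => Nat.not_even_iff_odd.mpr h' hh.2), h'.neg_one_pow]
      simp [wt]
  · simp [h]

end helpers

/-- `F₀(n) = (p̄(n) + p̄_o(n)) / 2`. -/
theorem F0_eq (n : ℕ) : (F0 n : ℚ) = ((pbar n : ℚ) + (pbarOdd n : ℚ)) / 2 := by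
  have h : 2 * (F0 n : ℤ) = pbar n + pbarOdd n := by
    rw [F0_coeff, pbar_coeff, pbarOdd_coeff, G_eq, euler, mul_comm (gf (wt fun _ => 1))]
  have h' : 2 * (F0 n : ℚ) = pbar n + pbarOdd n := by exact_mod_cast h
  linarith
end
end

section
/- For every nonnegative integer n, F_3(n) = (p̄(n) - (-1)^n · p̄_o(n))/2, where F_3(n) counts the partitions counted by F(n) having an odd total number of parts. -/
noncomputable section

namespace F3aux

def E (m : Multiset ℕ) : ℕ := (m.toFinset.filter (fun x => Even x)).sup id
def R (m : Multiset ℕ) : ℕ := (m.toFinset.filter (fun x => 2 ≤ m.count x)).sup id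

lemma le_E {m : Multiset ℕ} {x : ℕ} (hx : x ∈ m) (h : Even x) : x ≤ E m :=
  Finset.le_sup (f := id) (by simp [hx, h])

lemma le_R {m : Multiset ℕ} {x : ℕ} (h : 2 ≤ m.count x) : x ≤ R m :=
  Finset.le_sup (f := id) (by
    have : x ∈ m := Multiset.count_pos.1 (by omega)
    simp [this, h])

lemma E_mem {m : Multiset ℕ} (h : 0 < E m) : E m ∈ m ∧ Even (E m) := by
  by_cases hne : (m.toFinset.filter (fun x => Even x)).Nonempty
  · obtain ⟨x, hx, h2⟩ := Finset.exists_mem_eq_sup _ hne id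
    have : E m = x := h2
    rw [this]; simpa using hx
  · rw [Finset.not_nonempty_iff_eq_empty] at hne
    simp [E, hne] at h

lemma R_mem {m : Multiset ℕ} (h : 0 < R m) : 2 ≤ m.count (R m) := by
  by_cases hne : (m.toFinset.filter (fun x => 2 ≤ m.count x)).Nonempty
  · obtain ⟨x, hx, h2⟩ := Finset.exists_mem_eq_sup _ hne id
    have : R m = x := h2
    rw [this]; simp at hx; exact hx.2
  · rw [Finset.not_nonempty_iff_eq_empty] at hne
    simp [R, hne] at h

def inv (m : Multiset ℕ) : Multiset ℕ :=
  if 2 * R m ≤ E m then (E m / 2) ::ₘ (E m / 2) ::ₘ m.erase (E m)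
  else (2 * R m) ::ₘ (m.erase (R m)).erase (R m)

def Bad (m : Multiset ℕ) : Prop := ¬ ((∀ x ∈ m, Odd x) ∧ m.Nodup)

lemma inv_spec (m : Multiset ℕ) (hpos : ∀ x ∈ m, 0 < x) (hb : Bad m) :
    (∃ r m', 0 < r ∧ ((m = (2 * r) ::ₘ m' ∧ inv m = r ::ₘ r ::ₘ m') ∨
      (inv m = (2 * r) ::ₘ m' ∧ m = r ::ₘ r ::ₘ m'))) ∧ inv (inv m) = m := by
  by_cases hc : 2 * R m ≤ E m
  · have hE : 0 < E m := by
      by_contra h0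
      apply hb
      constructor
      · intro x hx
        by_contra hx2
        have := le_E hx (Nat.not_odd_iff_even.1 hx2)
        have := hpos x hx
        omega
      · rw [Multiset.nodup_iff_count_le_one]
        intro x
        by_contra hx2
        have := le_R (m := m) (x := x) (by omega)
        have := hpos x (Multiset.count_pos.1 (by omega))
        omega
    obtain ⟨hm, r, hr⟩ := E_mem hE
    obtain ⟨m', hm'⟩ := Multiset.exists_cons_of_mem hm
    have hr' : E m = 2 * r := by omega
    have hinv : inv m = r ::ₘ r ::ₘ m' := by
      rw [inv, if_pos hc]
      have h1 : m.erase (E m) = m' := by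
        have h2 := congrArg (fun t => Multiset.erase t (E m)) hm'
        simpa only [Multiset.erase_cons_head] using h2
      rw [h1, show E m / 2 = r by omega]
    have hm2 : m = (2 * r) ::ₘ m' := by rw [← hr']; exact hm'
    have hnot : 2 * r ∉ m' := by
      intro h
      have h1 := Multiset.count_pos.2 h
      have := le_R (m := m) (x := 2 * r) (by rw [hm2, Multiset.count_cons_self]; omega)
      omega
    refine ⟨⟨r, m', by omega, Or.inl ⟨hm2, hinv⟩⟩, ?_⟩
    have hRn : R (inv m) = r := by
      apply le_antisymm
      · by_contra hlt
        have h1 := R_mem (m := inv m) (by omega)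
        have h2 : R (inv m) ≤ R m := by
          apply le_R
          generalize R (inv m) = x at *
          rw [hm2]
          refine le_trans ?_ (Multiset.count_le_count_cons _ _ _)
          rw [hinv] at h1
          rwa [Multiset.count_cons_of_ne (by omega), Multiset.count_cons_of_ne (by omega)] at h1
        omega
      · apply le_R
        rw [hinv]; simp
    have hEn : E (inv m) < 2 * r := by
      by_contra hge
      obtain ⟨h1, h2⟩ := E_mem (m := inv m) (by omega)
      have h3 : E (inv m) ∈ m' := by
        have : E (inv m) ∈ r ::ₘ r ::ₘ m' := hinv ▸ h1
        rw [Multiset.mem_cons, Multiset.mem_cons] at this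
        rcases this with h | h | h
        · omega
        · omega
        · exact h
      have h4 : E (inv m) ≤ E m := le_E (by
        generalize E (inv m) = x at *
        rw [hm2]; exact Multiset.mem_cons_of_mem h3) h2
      have : E (inv m) = 2 * r := by omega
      exact hnot (this ▸ h3)
    rw [inv, if_neg (by omega), hRn, hinv]
    simp [hm2]
  · have hR : 0 < R m := by omega
    have h2 := R_mem hR
    set r := R m with hr
    obtain ⟨m1, hm1⟩ := Multiset.exists_cons_of_mem (Multiset.count_pos.1 (by omega : 0 < m.count r))
    have h3 : 0 < m1.count r := by rw [hm1, Multiset.count_cons_self] at h2; omega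
    obtain ⟨m', hm'⟩ := Multiset.exists_cons_of_mem (Multiset.count_pos.1 h3)
    have hm2 : m = r ::ₘ r ::ₘ m' := by rw [hm1, hm']
    have hinv : inv m = (2 * r) ::ₘ m' := by
      rw [inv, if_neg hc, ← hr]
      congr 1
      clear_value r
      rw [hm2]; simp
    refine ⟨⟨r, m', hR, Or.inr ⟨hinv, hm2⟩⟩, ?_⟩
    have hsub : ∀ x, m'.count x ≤ m.count x := fun x => by
      clear_value r
      rw [hm2]
      exact (Multiset.count_le_count_cons _ _ _).trans (Multiset.count_le_count_cons _ _ _)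
    have hev : ∀ x ∈ m', Even x → x < 2 * r := fun x hx hxe => by
      have : x ≤ E m := le_E (Multiset.count_pos.1 ((Multiset.count_pos.2 hx).trans_le (hsub x))) hxe
      omega
    have hEn : E (inv m) = 2 * r := by
      apply le_antisymm
      · by_contra hlt
        obtain ⟨h1, h4⟩ := E_mem (m := inv m) (by omega)
        have h5 : E (inv m) ∈ (2 * r) ::ₘ m' := hinv ▸ h1
        rcases Multiset.mem_cons.1 h5 with h | h
        · omega
        · have := hev _ h h4
          omega
      · exact le_E (by rw [hinv]; simp) (by simp)
    have hRn : R (inv m) ≤ r := by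
      by_contra hlt
      have h1 := R_mem (m := inv m) (by omega)
      have h5 : 2 ≤ ((2 * r) ::ₘ m').count (R (inv m)) := by
        rw [← hinv]; exact h1
      by_cases h6 : R (inv m) = 2 * r
      · rw [h6, Multiset.count_cons_self] at h5
        have := hev (2 * r) (Multiset.count_pos.1 (by omega)) (by simp)
        omega
      · rw [Multiset.count_cons_of_ne h6] at h5
        have := le_R (h5.trans (hsub _))
        omega
    rw [inv, if_pos (by omega), hEn, hinv]
    clear_value r
    simp [hm2]

lemma finite_le (n : ℕ) : {m : Multiset ℕ | (∀ x ∈ m, 0 < x) ∧ m.sum ≤ n}.Finite := by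
  apply Set.Finite.subset (s := ⋃ k ∈ Finset.range (n + 1), Set.range (fun p : Nat.Partition k => p.parts))
  · exact Set.Finite.biUnion (Finset.finite_toSet _) (fun k _ => Set.finite_range _)
  · rintro m ⟨h1, h2⟩
    simp only [Set.mem_iUnion]
    exact ⟨m.sum, by simp; omega, ⟨m, fun {i} hi => h1 i hi, rfl⟩, rfl⟩

lemma finite_F (n : ℕ) : (FSet n).Finite := by
  apply ((finite_le n).prod (finite_le n)).subset
  rintro ⟨a, b⟩ ⟨h1, h2, h3, h4⟩
  simp only at h1 h2 h3
  exact ⟨⟨h1, by simp only; omega⟩, ⟨h2, by simp only; omega⟩⟩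

lemma card_parity (m : Multiset ℕ) (h : ∀ x ∈ m, Odd x) : (-1 : ℤ) ^ m.card = (-1) ^ m.sum := by
  induction m using Multiset.induction with
  | empty => simp
  | cons a s ih =>
    rw [Multiset.card_cons, Multiset.sum_cons, pow_succ, pow_add,
      ih (fun x hx => h x (Multiset.mem_cons_of_mem hx)), (h a (Multiset.mem_cons_self _ _)).neg_one_pow]
    ring

lemma inv_props (m : Multiset ℕ) (hpos : ∀ x ∈ m, 0 < x) (hb : Bad m) :
    (∀ x ∈ inv m, 0 < x) ∧ Bad (inv m) ∧ (inv m).sum = m.sum ∧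
    (-1 : ℤ) ^ m.card + (-1) ^ (inv m).card = 0 := by
  obtain ⟨⟨r, m', hr, ⟨h1, h2⟩ | ⟨h2, h1⟩⟩, -⟩ := inv_spec m hpos hb
  · rw [h2, h1]
    rw [h1] at hpos
    refine ⟨?_, ?_, ?_, ?_⟩
    · intro x hx
      simp at hx hpos
      rcases hx with rfl | hx
      · exact hr
      · exact hpos.2 x hx
    · rintro ⟨-, h⟩
      simp at h
    · simp; ring
    · simp; ring
  · rw [h2, h1]
    rw [h1] at hpos
    refine ⟨?_, ?_, ?_, ?_⟩
    · intro x hx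
      simp at hx hpos
      rcases hx with rfl | hx
      · omega
      · exact hpos.2 x hx
    · rintro ⟨h, -⟩
      have := h (2 * r) (by simp)
      obtain ⟨t, ht⟩ := this
      omega
    · simp; ring
    · simp; ring

lemma signed (n : ℕ) : ∑ p ∈ (finite_F n).toFinset, (-1 : ℤ) ^ (p.1 + p.2).card
    = (-1) ^ n * (QSet n).ncard := by
  classical
  rw [← Finset.sum_filter_add_sum_filter_not _ (fun p => Bad p.1)]
  have h0 : ∑ p ∈ (finite_F n).toFinset with Bad p.1, (-1 : ℤ) ^ (p.1 + p.2).card = 0 := by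
    apply Finset.sum_involution (fun p _ => (inv p.1, p.2))
    · rintro ⟨a, b⟩ h
      simp only [Finset.mem_filter, Set.Finite.mem_toFinset] at h
      have := (inv_props a h.1.1 h.2).2.2.2
      simp only [Multiset.card_add, pow_add]
      rw [← add_mul, this, zero_mul]
    · rintro ⟨a, b⟩ h _ heq
      simp only [Finset.mem_filter, Set.Finite.mem_toFinset] at h
      have := (inv_props a h.1.1 h.2).2.2.2
      have h3 : inv a = a := (Prod.ext_iff.1 heq).1
      rw [h3] at this
      have h2 : (-1 : ℤ) ^ a.card ≠ 0 := by simp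
      omega
    · rintro ⟨a, b⟩ h
      simp only [Finset.mem_filter, Set.Finite.mem_toFinset] at h ⊢
      obtain ⟨h1, h2, h3, -⟩ := inv_props a h.1.1 h.2
      exact ⟨⟨h1, h.1.2.1, by simpa [h3] using h.1.2.2.1, h.1.2.2.2⟩, h2⟩
    · rintro ⟨a, b⟩ h
      simp only [Finset.mem_filter, Set.Finite.mem_toFinset] at h
      simp [(inv_spec a h.1.1 h.2).2]
  rw [h0, zero_add]
  have hQ : QSet n = ↑((finite_F n).toFinset.filter (fun p => ¬ Bad p.1)) := by
    ext p
    simp [QSet, Bad]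
  rw [hQ, Set.ncard_coe_finset, Finset.sum_congr rfl (g := fun _ => (-1 : ℤ) ^ n)]
  · simp [mul_comm]
  · rintro ⟨a, b⟩ h
    simp only [Finset.mem_filter, Set.Finite.mem_toFinset, Bad, not_not] at h
    rw [card_parity]
    · rw [Multiset.sum_add, h.1.2.2.1]
    · intro x hx
      rcases Multiset.mem_add.1 hx with hx | hx
      · exact h.2.1 x hx
      · exact h.1.2.2.2 x hx

lemma Q_eq (n : ℕ) : (QSet n).ncard = pbarOdd n := by
  refine Set.ncard_congr (fun p _ => (p.1.toFinset, p.2)) ?_ ?_ ?_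
  · rintro ⟨a, b⟩ ⟨⟨h1, h2, h3, h4⟩, h5, h6⟩
    refine ⟨⟨by simpa using h1, h2, ?_⟩, by simpa using h5, h4⟩
    simp only at h3 h6 ⊢
    rw [← h3, Finset.sum, Multiset.toFinset_val, h6.dedup, Multiset.map_id]
  · rintro ⟨a, b⟩ ⟨c, d⟩ ⟨-, -, h6⟩ ⟨-, -, h6'⟩ h
    simp only [Prod.mk.injEq] at h h6 h6' ⊢
    refine ⟨?_, h.2⟩
    have := congrArg Finset.val h.1
    rwa [Multiset.toFinset_val, Multiset.toFinset_val, h6.dedup, h6'.dedup] at this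
  · rintro ⟨a, b⟩ ⟨⟨h1, h2, h3⟩, h4, h5⟩
    refine ⟨(a.val, b), ⟨⟨h1, h2, ?_, h5⟩, h4, a.nodup⟩, by simp⟩
    simp only at h3 ⊢
    rw [← h3, Finset.sum, Multiset.map_id]

lemma euler (k : ℕ) : ∃ f : Multiset ℕ → Finset ℕ,
    Set.BijOn f {m | (∀ x ∈ m, 0 < x) ∧ (∀ x ∈ m, Odd x) ∧ m.sum = k}
      {s | (∀ x ∈ s, 0 < x) ∧ s.sum id = k} := by
  have h1 : {m : Multiset ℕ | (∀ x ∈ m, 0 < x) ∧ (∀ x ∈ m, Odd x) ∧ m.sum = k} =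
      (fun p : Nat.Partition k => p.parts) '' (Nat.Partition.odds k) := by
    ext m
    constructor
    · rintro ⟨h1, h2, h3⟩
      refine ⟨⟨m, fun {i} hi => h1 i hi, h3⟩, ?_, rfl⟩
      simpa [Nat.Partition.odds, Nat.Partition.restricted] using h2
    · rintro ⟨p, hp, rfl⟩
      refine ⟨fun x hx => p.parts_pos hx, ?_, p.parts_sum⟩
      simpa [Nat.Partition.odds, Nat.Partition.restricted] using hp
  have h2 : {s : Finset ℕ | (∀ x ∈ s, 0 < x) ∧ s.sum id = k} =
      (fun p : Nat.Partition k => p.parts.toFinset) '' (Nat.Partition.distincts k) := by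
    ext s
    constructor
    · rintro ⟨h1, h3⟩
      refine ⟨⟨s.val, fun {i} hi => h1 i hi, by rw [← h3, Finset.sum, Multiset.map_id]⟩, ?_, by simp⟩
      simpa [Nat.Partition.distincts] using s.nodup
    · rintro ⟨p, hp, rfl⟩
      have hp' : p.parts.Nodup := by simpa [Nat.Partition.distincts] using hp
      refine ⟨fun x hx => p.parts_pos (by simpa using hx), ?_⟩
      rw [Finset.sum, Multiset.toFinset_val, hp'.dedup, Multiset.map_id, p.parts_sum]
  rw [h1, h2]
  apply Set.Finite.exists_bijOn_of_encard_eq ((Finset.finite_toSet _).image _)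
  rw [Set.InjOn.encard_image, Set.InjOn.encard_image]
  · rw [Set.encard_coe_eq_coe_finsetCard, Set.encard_coe_eq_coe_finsetCard,
      Nat.Partition.card_odds_eq_card_distincts]
  · intro p hp q hq h
    have hp' : p.parts.Nodup := by simpa [Nat.Partition.distincts] using hp
    have hq' : q.parts.Nodup := by simpa [Nat.Partition.distincts] using hq
    have := congrArg Finset.val h
    simp only at this
    rw [Multiset.toFinset_val, Multiset.toFinset_val, hp'.dedup, hq'.dedup] at this
    exact Nat.Partition.ext this
  · intro p hp q hq h
    exact Nat.Partition.ext h

lemma F_eq (n : ℕ) : (FSet n).ncard = pbar n := by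
  choose f hf using euler
  refine Set.ncard_congr (fun p _ => (f p.2.sum p.2, p.1)) ?_ ?_ ?_
  · rintro ⟨a, b⟩ ⟨h1, h2, h3, h4⟩
    obtain ⟨h5, h6⟩ := (hf b.sum).mapsTo ⟨h2, h4, rfl⟩
    exact ⟨h5, h1, by simp only at h6 h3 ⊢; omega⟩
  · rintro ⟨a, b⟩ ⟨c, d⟩ ⟨h1, h2, h3, h4⟩ ⟨h1', h2', h3', h4'⟩ h
    simp only [Prod.mk.injEq] at *
    obtain ⟨h5, rfl⟩ := h
    have hs : d.sum = b.sum := by omega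
    rw [hs] at h5
    exact ⟨rfl, (hf b.sum).injOn ⟨h2, h4, rfl⟩ ⟨h2', h4', hs⟩ h5⟩
  · rintro ⟨s, a⟩ ⟨h1, h2, h3⟩
    obtain ⟨b, ⟨h4, h5, h6⟩, h7⟩ := (hf (s.sum id)).surjOn ⟨h1, rfl⟩
    refine ⟨(a, b), ⟨h2, h4, ?_, h5⟩, ?_⟩
    · simp only at h3 ⊢; omega
    · simp only [h6, h7]

end F3aux

/-- `F₃(n) = (p̄(n) - (-1)^n * p̄_o(n)) / 2`. -/
theorem F3_eq (n : ℕ) : (F3 n : ℚ) = ((pbar n : ℚ) - (-1) ^ n * (pbarOdd n : ℚ)) / 2 := by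
  classical
  have h1 := F3aux.signed n
  rw [F3aux.Q_eq] at h1
  have h2 := F3aux.F_eq n
  rw [Set.ncard_eq_toFinset_card _ (F3aux.finite_F n)] at h2
  have h3 : F3 n = ((F3aux.finite_F n).toFinset.filter (fun p => Odd (p.1 + p.2).card)).card := by
    rw [F3, ← Set.ncard_coe_finset]
    congr 1
    ext p
    simp
  have h4 : ∑ p ∈ (F3aux.finite_F n).toFinset, (-1 : ℤ) ^ (p.1 + p.2).card =
      ∑ p ∈ (F3aux.finite_F n).toFinset, (1 - 2 * if Odd (p.1 + p.2).card then 1 else 0) := by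
    apply Finset.sum_congr rfl
    intro p _
    split_ifs with h
    · rw [h.neg_one_pow]; norm_num
    · rw [(Nat.not_odd_iff_even.1 h).neg_one_pow]; norm_num
  rw [h4, Finset.sum_sub_distrib, ← Finset.mul_sum, Finset.sum_boole, ← h3, Finset.sum_const, h2] at h1
  have h5 : (((pbar n : ℤ) - 2 * (F3 n : ℤ) : ℤ) : ℚ) = ((-1) ^ n * (pbarOdd n : ℤ) : ℤ) := by
    rw [← h1]; simp
  push_cast at h5
  linarith
end
end

section
/- For every nonnegative integer n, F_0(n) - F_1(n) = p̄_o(n), where F_0(n) (resp. F_1(n)) counts the partitions counted by F(n) with an even (resp. odd) number of even parts, and p̄_o(n) is the number of overpartitions of n into odd parts. -/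
noncomputable section

def BigA (m : Multiset ℕ) (a : ℕ) : Prop := 2 * a ∈ m ∨ 2 ≤ m.count a

def IsTopA (m : Multiset ℕ) (a : ℕ) : Prop := BigA m a ∧ ∀ b, a < b → ¬ BigA m b

def togA (a : ℕ) (m : Multiset ℕ) : Multiset ℕ :=
  if 2 * a ∈ m then a ::ₘ a ::ₘ m.erase (2 * a) else (2 * a) ::ₘ (m.erase a).erase a

open Classical in
def topA (m : Multiset ℕ) : ℕ := if h : ∃ a, IsTopA m a then h.choose else 0

theorem isTop_unique {m : Multiset ℕ} {a b : ℕ} (ha : IsTopA m a) (hb : IsTopA m b) : a = b := by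
  rcases lt_trichotomy a b with h | h | h
  · exact absurd hb.1 (ha.2 b h)
  · exact h
  · exact absurd ha.1 (hb.2 a h)

theorem topA_eq {m : Multiset ℕ} {a : ℕ} (ha : IsTopA m a) : topA m = a := by
  have h : ∃ a, IsTopA m a := ⟨a, ha⟩
  unfold topA
  rw [dif_pos h]
  exact isTop_unique h.choose_spec ha

theorem bigA_le {m : Multiset ℕ} {a : ℕ} (h : BigA m a) : a ≤ m.sum := by
  rcases h with h | h
  · have := Multiset.le_sum_of_mem h
    omega
  · exact Multiset.le_sum_of_mem (Multiset.count_pos.1 (by omega))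

theorem exists_top {m : Multiset ℕ} (h : ∃ a, BigA m a) : ∃ a, IsTopA m a := by
  classical
  obtain ⟨a, ha⟩ := h
  refine ⟨Nat.findGreatest (BigA m) m.sum, Nat.findGreatest_spec (bigA_le ha) ha, ?_⟩
  intro b hb hB
  exact absurd (Nat.le_findGreatest (bigA_le hB) hB) (by omega)

theorem top_pos {m : Multiset ℕ} (hm : ∀ x ∈ m, 0 < x) {a : ℕ} (h : BigA m a) : 0 < a := by
  rcases h with h | h
  · have := hm _ h
    omega
  · exact hm _ (Multiset.count_pos.1 (by omega))

theorem decomp2 {m : Multiset ℕ} {a : ℕ} (h : 2 ≤ m.count a) : ∃ r, m = a ::ₘ a ::ₘ r := by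
  have h1 : Multiset.replicate 2 a ≤ m := Multiset.le_count_iff_replicate_le.1 h
  obtain ⟨r, rfl⟩ := Multiset.le_iff_exists_add.1 h1
  exact ⟨r, by simp [Multiset.replicate_succ]⟩

/-- Every top situation is one of two dual ones. -/
theorem top_cases {m : Multiset ℕ} {a : ℕ} (ha0 : 0 < a) (h : IsTopA m a) :
    ∃ r, 2 * a ∉ r ∧ ((m = (2 * a) ::ₘ r ∧ togA a m = a ::ₘ a ::ₘ r) ∨
      (m = a ::ₘ a ::ₘ r ∧ togA a m = (2 * a) ::ₘ r)) := by
  by_cases h2 : 2 * a ∈ m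
  · obtain ⟨r, rfl⟩ := Multiset.exists_cons_of_mem h2
    refine ⟨r, ?_, Or.inl ⟨rfl, ?_⟩⟩
    · intro hr
      refine h.2 (2 * a) (by omega) (Or.inr ?_)
      have := Multiset.count_pos.2 hr
      rw [Multiset.count_cons_self]
      omega
    · simp [togA]
  · have hc : 2 ≤ m.count a := h.1.resolve_left h2
    obtain ⟨r, rfl⟩ := decomp2 hc
    refine ⟨r, fun hr => h2 (by simp [hr]), Or.inr ⟨rfl, ?_⟩⟩
    rw [togA, if_neg h2]
    simp

theorem tog_pair {r : Multiset ℕ} {a : ℕ} (ha0 : 0 < a) (hr : 2 * a ∉ r) :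
    togA a ((2 * a) ::ₘ r) = a ::ₘ a ::ₘ r ∧ togA a (a ::ₘ a ::ₘ r) = (2 * a) ::ₘ r := by
  constructor
  · simp [togA]
  · have : 2 * a ∉ a ::ₘ a ::ₘ r := by
      simp only [Multiset.mem_cons, not_or]
      exact ⟨by omega, by omega, hr⟩
    rw [togA, if_neg this]
    simp

theorem top_pair {r : Multiset ℕ} {a : ℕ} (ha0 : 0 < a) (hr : 2 * a ∉ r) :
    IsTopA ((2 * a) ::ₘ r) a ↔ IsTopA (a ::ₘ a ::ₘ r) a := by
  have h0 : r.count (2 * a) = 0 := Multiset.count_eq_zero.2 hr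
  have key : ∀ b, a < b → (BigA ((2 * a) ::ₘ r) b ↔ BigA (a ::ₘ a ::ₘ r) b) := by
    intro b hb
    unfold BigA
    simp only [Multiset.mem_cons, Multiset.count_cons]
    have e1 : ¬ (2 * b = 2 * a) := by omega
    have e2 : ¬ (2 * b = a) := by omega
    have e3 : ¬ (b = a) := by omega
    simp only [e1, e2, e3, false_or, if_false, add_zero]
    by_cases e : b = 2 * a
    · subst e
      simp [h0]
    · simp [e]
  have b1 : BigA ((2 * a) ::ₘ r) a := Or.inl (by simp)
  have b2 : BigA (a ::ₘ a ::ₘ r) a := Or.inr (by simp)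
  constructor
  · intro h
    exact ⟨b2, fun b hb hB => h.2 b hb ((key b hb).2 hB)⟩
  · intro h
    exact ⟨b1, fun b hb hB => h.2 b hb ((key b hb).1 hB)⟩

def togM (m : Multiset ℕ) : Multiset ℕ := togA (topA m) m

theorem evenParts_cons (a : ℕ) (m : Multiset ℕ) :
    evenParts (a ::ₘ m) = (if Even a then 1 else 0) + evenParts m := by
  unfold evenParts
  by_cases h : Even a
  · simp [h, add_comm]
  · simp [h]

theorem evenParts_add (m k : Multiset ℕ) :
    evenParts (m + k) = evenParts m + evenParts k := by
  simp [evenParts]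

theorem togM_spec {m : Multiset ℕ} (hm : ∀ x ∈ m, 0 < x) (h : ∃ a, BigA m a) :
    togM (togM m) = m ∧ (togM m).sum = m.sum ∧ (∀ x ∈ togM m, 0 < x) ∧ (∃ a, BigA (togM m) a) ∧
      (Even (evenParts (togM m)) ↔ ¬ Even (evenParts m)) := by
  obtain ⟨a, ha⟩ := exists_top h
  have ha0 := top_pos hm ha.1
  have e1 : togM m = togA a m := by rw [togM, topA_eq ha]
  obtain ⟨r, hr, ⟨rfl, h2⟩ | ⟨rfl, h2⟩⟩ := top_cases ha0 ha
  · have ht := (top_pair ha0 hr).1 ha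
    rw [e1, h2]
    refine ⟨?_, ?_, ?_, ⟨a, ht.1⟩, ?_⟩
    · rw [togM, topA_eq ht, (tog_pair ha0 hr).2]
    · simp only [Multiset.sum_cons]; ring
    · intro x hx
      simp only [Multiset.mem_cons] at hx
      rcases hx with rfl | rfl | hx
      · exact ha0
      · exact ha0
      · exact hm x (by simp [hx])
    · simp only [evenParts_cons]
      split_ifs <;> simp_all [Nat.even_add, parity_simps]
  · have ht := (top_pair ha0 hr).2 ha
    rw [e1, h2]
    refine ⟨?_, ?_, ?_, ⟨a, ht.1⟩, ?_⟩
    · rw [togM, topA_eq ht, (tog_pair ha0 hr).1]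
    · simp only [Multiset.sum_cons]; ring
    · intro x hx
      simp only [Multiset.mem_cons] at hx
      rcases hx with rfl | hx
      · omega
      · exact hm x (by simp [hx])
    · simp only [evenParts_cons]
      split_ifs <;> simp_all [Nat.even_add, parity_simps]

theorem not_big_iff (m : Multiset ℕ) :
    (¬ ∃ a, BigA m a) ↔ (∀ x ∈ m, Odd x) ∧ m.Nodup := by
  constructor
  · intro h
    constructor
    · intro x hx
      by_contra hx'
      obtain ⟨k, rfl⟩ := (Nat.not_odd_iff_even.1 hx')
      exact h ⟨k, Or.inl (by rwa [two_mul])⟩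
    · rw [Multiset.nodup_iff_count_le_one]
      intro a
      by_contra hc
      exact h ⟨a, Or.inr (by omega)⟩
  · rintro ⟨h1, h2⟩ ⟨a, h | h⟩
    · have := h1 _ h
      rw [Nat.odd_iff] at this
      omega
    · have := Multiset.nodup_iff_count_le_one.1 h2 a
      omega

theorem evenParts_odd {m : Multiset ℕ} (h : ∀ x ∈ m, Odd x) : evenParts m = 0 := by
  unfold evenParts
  rw [Multiset.card_eq_zero, Multiset.filter_eq_nil]
  intro x hx
  exact Nat.not_even_iff_odd.2 (h x hx)

theorem finite_ms (n : ℕ) : {m : Multiset ℕ | (∀ x ∈ m, 0 < x) ∧ m.sum ≤ n}.Finite := by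
  have : {m : Multiset ℕ | (∀ x ∈ m, 0 < x) ∧ m.sum ≤ n} ⊆
      ⋃ k ∈ Set.Iic n, Set.range (fun p : Nat.Partition k => p.parts) := by
    rintro m ⟨h1, h2⟩
    simp only [Set.mem_iUnion]
    exact ⟨m.sum, h2, ⟨m, fun {i} hi => h1 i hi, rfl⟩, rfl⟩
  refine Set.Finite.subset ?_ this
  exact (Set.finite_Iic n).biUnion (fun k _ => Set.finite_range _)

theorem finite_FSet (n : ℕ) : (FSet n).Finite := by
  refine ((finite_ms n).prod (finite_ms n)).subset ?_
  rintro p ⟨h1, h2, h3, h4⟩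
  exact ⟨⟨h1, by omega⟩, ⟨h2, by omega⟩⟩

theorem Qcount_eq (n : ℕ) : (QSet n).ncard = pbarOdd n := by
  unfold pbarOdd
  symm
  refine Set.ncard_congr (fun p _ => (p.1.val, p.2)) ?_ ?_ ?_
  · rintro ⟨s, g⟩ ⟨⟨h1, h2, h3⟩, h4, h5⟩
    refine ⟨⟨h1, h2, ?_, h5⟩, h4, s.nodup⟩
    simpa only [Finset.sum, Multiset.map_id] using h3
  · rintro ⟨s, g⟩ ⟨t, k⟩ _ _ h
    simp only [Prod.mk.injEq, Finset.val_inj] at h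
    exact Prod.ext h.1 h.2
  · rintro ⟨m, g⟩ ⟨⟨h1, h2, h3, h4⟩, h5, h6⟩
    refine ⟨(⟨m, h6⟩, g), ⟨⟨h1, h2, ?_⟩, h5, h4⟩, rfl⟩
    simpa [Finset.sum] using h3

theorem big_card (n : ℕ) :
    {p ∈ FSet n | (∃ a, BigA p.1 a) ∧ Even (evenParts (p.1 + p.2))}.ncard =
    {p ∈ FSet n | (∃ a, BigA p.1 a) ∧ Odd (evenParts (p.1 + p.2))}.ncard := by
  refine Set.ncard_congr (fun p _ => (togM p.1, p.2)) ?_ ?_ ?_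
  · rintro ⟨m, g⟩ ⟨⟨h1, h2, h3, h4⟩, h5, h6⟩
    obtain ⟨s1, s2, s3, s4, s5⟩ := togM_spec h1 h5
    refine ⟨⟨s3, h2, by simpa [s2] using h3, h4⟩, s4, ?_⟩
    simp only [evenParts_add, evenParts_odd h4, add_zero] at h6 ⊢
    rw [← Nat.not_even_iff_odd, s5]
    simpa using h6
  · rintro ⟨m, g⟩ ⟨m', g'⟩ ⟨⟨h1, h2, h3, h4⟩, h5, h6⟩ ⟨⟨h1', _⟩, h5', _⟩ h
    simp only [Prod.mk.injEq] at h
    have := (togM_spec h1 h5).1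
    rw [h.1, (togM_spec h1' h5').1] at this
    simp only at this
    rw [this, h.2]
  · rintro ⟨m, g⟩ ⟨⟨h1, h2, h3, h4⟩, h5, h6⟩
    obtain ⟨s1, s2, s3, s4, s5⟩ := togM_spec h1 h5
    refine ⟨(togM m, g), ⟨⟨s3, h2, by simpa [s2] using h3, h4⟩, s4, ?_⟩, ?_⟩
    · simp only [evenParts_add, evenParts_odd h4, add_zero] at h6 ⊢
      rw [s5]
      simpa using h6
    · simp only at s1
      simp [s1]

theorem F1_eq (n : ℕ) :
    F1 n = {p ∈ FSet n | (∃ a, BigA p.1 a) ∧ Odd (evenParts (p.1 + p.2))}.ncard := by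
  unfold F1
  congr 1
  ext ⟨m, g⟩
  constructor
  · rintro ⟨h, h'⟩
    refine ⟨h, ?_, h'⟩
    by_contra hb
    have := ((not_big_iff m).1 hb).1
    simp [evenParts_add, evenParts_odd this, evenParts_odd h.2.2.2] at h'
  · rintro ⟨h, _, h'⟩
    exact ⟨h, h'⟩

theorem F0_eq_s5 (n : ℕ) :
    F0 n = {p ∈ FSet n | (∃ a, BigA p.1 a) ∧ Even (evenParts (p.1 + p.2))}.ncard
      + (QSet n).ncard := by
  rw [← Set.ncard_union_eq ?_ ((finite_FSet n).subset (fun p hp => hp.1))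
    ((finite_FSet n).subset (fun p hp => hp.1))]
  · unfold F0
    congr 1
    ext ⟨m, g⟩
    constructor
    · rintro ⟨h, h'⟩
      by_cases hb : ∃ a, BigA m a
      · exact Or.inl ⟨h, hb, h'⟩
      · exact Or.inr ⟨h, (not_big_iff m).1 hb⟩
    · rintro (⟨h, _, h'⟩ | ⟨h, h1, h2⟩)
      · exact ⟨h, h'⟩
      · refine ⟨h, ?_⟩
        have e1 : evenParts m = 0 := evenParts_odd h1
        have e2 : evenParts g = 0 := evenParts_odd h.2.2.2
        simp [evenParts_add, e1, e2]
  · rw [Set.disjoint_left]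
    rintro ⟨m, g⟩ ⟨_, hb, _⟩ ⟨_, h⟩
    exact (not_big_iff m).2 h hb

/-- `F₀(n) - F₁(n) = p̄_o(n)`. -/
theorem F0_sub_F1 (n : ℕ) : (F0 n : ℤ) - (F1 n : ℤ) = (pbarOdd n : ℤ) := by
  rw [F0_eq_s5, F1_eq, big_card, Qcount_eq]
  push_cast
  ring
end
end
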